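/- The set B_inv = {α₁^a · α₂^b · α₃^c · γ₁^{2d+f} · γ₂^{2e+f} : a, b, d, e ∈ ℤ_{≥0}, c, f ∈ {0,1}} is a ℂ-vector space basis of (Q^{S₃})^{U_n}, the space of polynomials in Q that are invariant under both the column-permutation action of S₃ and the action of U_n. -/

import Mathlib

open MvPolynomial

noncomputable section

/-- The polynomial ring `𝒫 = ℂ[x_{ij} : 1 ≤ i ≤ n, 1 ≤ j ≤ 3]` in the entries of an
`n × 3` matrix of indeterminates. -/
abbrev P (n : ℕ) : Type := MvPolynomial (Fin n × Fin 3) ℂ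

/-- The action of a matrix `g` on `𝒫`, given by `(g · f)(X) = f(gᵀ X)`;
on variables it sends `x_{ij} ↦ ∑ s g_{si} x_{sj}`. -/
def matAct (n : ℕ) (g : Matrix (Fin n) (Fin n) ℂ) : P n →ₐ[ℂ] P n :=
  aeval fun p : Fin n × Fin 3 => ∑ s : Fin n, C (g s p.1) * X (s, p.2)

/-- The action of `σ ∈ S₃` permuting columns: `x_{ij} ↦ x_{iσ(j)}`. -/
def permAct (n : ℕ) (σ : Equiv.Perm (Fin 3)) : P n →ₐ[ℂ] P n :=
  aeval fun p : Fin n × Fin 3 => X (p.1, σ p.2)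

/-- `g` is upper triangular with all diagonal entries equal to `1`, i.e. `g ∈ U_n`. -/
def IsUpperUni (n : ℕ) (g : Matrix (Fin n) (Fin n) ℂ) : Prop :=
  (∀ i, g i i = 1) ∧ ∀ i j, j < i → g i j = 0

/-- `f` is `U_n`-invariant. -/
def UInv (n : ℕ) (f : P n) : Prop :=
  ∀ g : Matrix (Fin n) (Fin n) ℂ, IsUpperUni n g → matAct n g f = f

/-- `f ∈ Q_m` : each monomial of `f` has total degree `m` in the column-`j` variables,
for each `j`. -/
def InQm (n m : ℕ) (f : P n) : Prop :=
  ∀ d ∈ f.support, ∀ j : Fin 3, (∑ i : Fin n, d (i, j)) = m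

/-- `f ∈ Q = ⊕ₘ Q_m` : each monomial of `f` has equal total degree in the three columns. -/
def InQ (n : ℕ) (f : P n) : Prop :=
  ∀ d ∈ f.support, ∀ j : Fin 3, (∑ i : Fin n, d (i, j)) = ∑ i : Fin n, d (i, (0 : Fin 3))

/-- The variable `x_{(i+1)(j+1)}`, `i j : Fin 3` (0-indexed rows and columns). -/
def Xe (n : ℕ) (hn : 3 ≤ n) (i j : Fin 3) : P n := X (Fin.castLE hn i, j)

/-- `δ_{ij} = x_{1i} x_{2j} - x_{2i} x_{1j}` (0-indexed columns `i j : Fin 3`). -/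
def del (n : ℕ) (hn : 3 ≤ n) (i j : Fin 3) : P n :=
  Xe n hn 0 i * Xe n hn 1 j - Xe n hn 1 i * Xe n hn 0 j

/-- `α₁ = x₁₁ x₁₂ x₁₃`. -/
def alpha1 (n : ℕ) (hn : 3 ≤ n) : P n := Xe n hn 0 0 * Xe n hn 0 1 * Xe n hn 0 2

/-- `β₂ = x₁₂ δ₁₃`. -/
def beta2 (n : ℕ) (hn : 3 ≤ n) : P n := Xe n hn 0 1 * del n hn 0 2

/-- `β₃ = x₁₃ δ₁₂`. -/
def beta3 (n : ℕ) (hn : 3 ≤ n) : P n := Xe n hn 0 2 * del n hn 0 1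

/-- `γ₁ = det (x_{ij})_{1 ≤ i,j ≤ 3}`. -/
def gamma1 (n : ℕ) (hn : 3 ≤ n) : P n := Matrix.det (Matrix.of fun i j : Fin 3 => Xe n hn i j)

/-- `γ₂ = δ₁₂ δ₁₃ δ₂₃`. -/
def gamma2 (n : ℕ) (hn : 3 ≤ n) : P n := del n hn 0 1 * del n hn 0 2 * del n hn 1 2

/-- `α₂ = β₂² + β₃² − β₂ β₃`. -/
def alpha2 (n : ℕ) (hn : 3 ≤ n) : P n := beta2 n hn ^ 2 + beta3 n hn ^ 2 - beta2 n hn * beta3 n hn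

/-- `α₃ = 2(β₂³ + β₃³) − 3(β₂² β₃ + β₂ β₃²)`. -/
def alpha3 (n : ℕ) (hn : 3 ≤ n) : P n :=
  2 * (beta2 n hn ^ 3 + beta3 n hn ^ 3) -
    3 * (beta2 n hn ^ 2 * beta3 n hn + beta2 n hn * beta3 n hn ^ 2)

/-- The family `B_inv`, indexed by `(a, b, c, d, e, f)` with `a b d e : ℕ` and `c f ∈ {0,1}`:
`α₁^a α₂^b α₃^c γ₁^{2d+f} γ₂^{2e+f}`. -/
def Binv (n : ℕ) (hn : 3 ≤ n) : ℕ × ℕ × Fin 2 × ℕ × ℕ × Fin 2 → P n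
  | (a, b, c, d, e, f) =>
      alpha1 n hn ^ a * alpha2 n hn ^ b * alpha3 n hn ^ (c : ℕ) *
        gamma1 n hn ^ (2 * d + (f : ℕ)) * gamma2 n hn ^ (2 * e + (f : ℕ))

/-- Rescaling of the columns: `x_{ij} ↦ t_j x_{ij}`. -/
def scaleAct (n : ℕ) (t : Fin 3 → ℂ) : P n →ₐ[ℂ] P n :=
  aeval fun p : Fin n × Fin 3 => C (t p.2) * X p

lemma scaleAct_monomial (n : ℕ) (t : Fin 3 → ℂ) (d : Fin n × Fin 3 →₀ ℕ) (a : ℂ) :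
    scaleAct n t (monomial d a) = monomial d ((∏ j, t j ^ ∑ i, d (i, j)) * a) := by
  rw [scaleAct, aeval_monomial, Finsupp.prod_fintype _ _ (fun _ => pow_zero _)]
  simp_rw [mul_pow, Finset.prod_mul_distrib]
  rw [monomial_eq (s := d), Finsupp.prod_fintype _ _ (fun _ => pow_zero _),
    Fintype.prod_prod_type_right]
  simp only [Finset.prod_pow_eq_pow_sum, algebraMap_eq, map_mul, map_prod, map_pow]
  ring

lemma coeff_scaleAct (n : ℕ) (t : Fin 3 → ℂ) (f : P n) (d : Fin n × Fin 3 →₀ ℕ) :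
    coeff d (scaleAct n t f) = (∏ j, t j ^ ∑ i, d (i, j)) * coeff d f := by
  classical
  induction f using MvPolynomial.induction_on' with
  | monomial e a =>
    rw [scaleAct_monomial, coeff_monomial, coeff_monomial]
    split_ifs with h
    · rw [h]
    · simp
  | add p q hp hq => rw [map_add, coeff_add, coeff_add, hp, hq, mul_add]

/-- Membership in `Q` is invariance under column rescalings of determinant `1`. -/
lemma inQ_iff (n : ℕ) (f : P n) :
    InQ n f ↔ ∀ t : Fin 3 → ℂ, t 0 * t 1 * t 2 = 1 → scaleAct n t f = f := by
  constructor
  · intro h t ht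
    ext d
    rw [coeff_scaleAct]
    by_cases hd : d ∈ f.support
    · rw [Fin.prod_univ_three, h d hd 1, h d hd 2, ← mul_pow, ← mul_pow, ht, one_pow, one_mul]
    · rw [notMem_support_iff.mp hd, mul_zero]
  · intro h d hd
    have hd' : coeff d f ≠ 0 := mem_support_iff.mp hd
    have key : ∀ t : Fin 3 → ℂ, t 0 * t 1 * t 2 = 1 → ∏ j, t j ^ ∑ i, d (i, j) = 1 := by
      intro t ht
      have := congrArg (coeff d) (h t ht)
      rw [coeff_scaleAct] at this
      exact mul_right_cancel₀ hd' (by rw [this, one_mul])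
    have h2 : ∀ a b : ℕ, (2 : ℂ) ^ a * (2⁻¹ : ℂ) ^ b = 1 → b = a := by
      intro a b hab
      rw [inv_pow, mul_inv_eq_one₀ (pow_ne_zero _ two_ne_zero)] at hab
      have : (2 : ℕ) ^ a = 2 ^ b := by exact_mod_cast hab
      exact (Nat.pow_right_injective le_rfl this).symm
    have h01 := key ![2, 2⁻¹, 1] (by simp)
    have h02 := key ![2, 1, 2⁻¹] (by simp)
    simp only [Fin.prod_univ_three, Matrix.cons_val, one_pow, mul_one] at h01 h02
    intro j
    fin_cases j
    · rfl
    · exact h2 _ _ h01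
    · exact h2 _ _ h02

lemma eval_scaleAct (n : ℕ) (t : Fin 3 → ℂ) (f : P n) (x : Fin n × Fin 3 → ℂ) :
    eval x (scaleAct n t f) = eval (fun p => t p.2 * x p) f := by
  induction f using MvPolynomial.induction_on with
  | C a => simp [scaleAct]
  | add p q hp hq => simp [hp, hq]
  | mul_X p i hp => rw [map_mul, map_mul, map_mul, hp]; simp [scaleAct]

lemma eval_matAct (n : ℕ) (g : Matrix (Fin n) (Fin n) ℂ) (f : P n) (x : Fin n × Fin 3 → ℂ) :
    eval x (matAct n g f) = eval (fun p => ∑ s, g s p.1 * x (s, p.2)) f := by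
  induction f using MvPolynomial.induction_on with
  | C a => simp [matAct]
  | add p q hp hq => simp [hp, hq]
  | mul_X p i hp => rw [map_mul, map_mul, map_mul, hp]; simp [matAct]

/-- A `U_n`-invariant takes the same value at two matrices when each row of one differs from the
corresponding row of the other by a combination of earlier rows. -/
lemma eval_eq_of_rows {n : ℕ} {f : P n} (hf : UInv n f) (x y : Fin n × Fin 3 → ℂ)
    (h : ∀ i, ∃ c : Fin n → ℂ, ∀ j, y (i, j) = x (i, j) + ∑ s, if s < i then c s * x (s, j) else 0) :
    eval y f = eval x f := by
  choose c hc using h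
  let g : Matrix (Fin n) (Fin n) ℂ := fun s i => if s = i then 1 else if s < i then c i s else 0
  have hg : IsUpperUni n g := by
    refine ⟨fun i => by simp [g], fun i j hij => ?_⟩
    simp [g, hij.ne', hij.not_gt]
  conv_rhs => rw [← hf g hg]
  rw [eval_matAct]
  congr 2
  funext ⟨i, j⟩
  have : ∀ s, g s i * x (s, j) =
      (if s = i then x (i, j) else 0) + if s < i then c i s * x (s, j) else 0 := by
    intro s
    by_cases hs : s = i
    · subst hs; simp [g]
    · simp [g, hs]
  simp only [this, Finset.sum_add_distrib]
  simpa using hc i j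

/-- The matrix with rows `(a, 1, 1)`, `(0, b₃/a, b₂/a)`, `(0, 0, c/b₃)`, followed by zero rows. -/
def normalForm (n : ℕ) (a b₂ b₃ c : ℂ) : Fin n × Fin 3 → ℂ := fun p =>
  if p.1.val = 0 then ![a, 1, 1] p.2
  else if p.1.val = 1 then ![0, b₃ / a, b₂ / a] p.2
  else if p.1.val = 2 then ![0, 0, c / b₃] p.2
  else 0

section
variable (n : ℕ) (hn : 3 ≤ n)

lemma exists_rowcomb (x : Fin n × Fin 3 → ℂ) (i : Fin n) (v : Fin 3 → ℂ) (c₀ c₁ c₂ : ℂ)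
    (h₀ : c₀ = 0 ∨ 0 < i.val) (h₁ : c₁ = 0 ∨ 1 < i.val) (h₂ : c₂ = 0 ∨ 2 < i.val)
    (h : ∀ j, v j = x (i, j) + (c₀ * x (Fin.castLE hn 0, j) + c₁ * x (Fin.castLE hn 1, j) +
      c₂ * x (Fin.castLE hn 2, j))) :
    ∃ c : Fin n → ℂ, ∀ j, v j = x (i, j) + ∑ s, if s < i then c s * x (s, j) else 0 := by
  refine ⟨fun s => (if s = Fin.castLE hn 0 then c₀ else 0) +
    (if s = Fin.castLE hn 1 then c₁ else 0) + (if s = Fin.castLE hn 2 then c₂ else 0),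
    fun j => ?_⟩
  rw [h j]
  congr 1
  have key : ∀ (k : Fin 3) (e : ℂ), (e = 0 ∨ k.val < i.val) → e * x (Fin.castLE hn k, j) =
      ∑ s, if s = Fin.castLE hn k then (if s < i then e * x (s, j) else 0) else 0 := by
    intro k e hk
    rw [Finset.sum_ite_eq' Finset.univ, if_pos (Finset.mem_univ _)]
    rcases hk with rfl | hk
    · simp
    · rw [if_pos (by simpa [Fin.lt_def] using hk)]
  rw [key 0 c₀ h₀, key 1 c₁ h₁, key 2 c₂ h₂, ← Finset.sum_add_distrib, ← Finset.sum_add_distrib]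
  refine Finset.sum_congr rfl fun s _ => ?_
  by_cases hs : s < i
  · simp only [hs, if_true, add_mul, ite_mul, zero_mul]
  · simp [hs]

lemma eval_alpha1 (x : Fin n × Fin 3 → ℂ) : eval x (alpha1 n hn) =
    x (Fin.castLE hn 0, 0) * x (Fin.castLE hn 0, 1) * x (Fin.castLE hn 0, 2) := by
  simp [alpha1, Xe]

lemma eval_beta2 (x : Fin n × Fin 3 → ℂ) : eval x (beta2 n hn) =
    x (Fin.castLE hn 0, 1) * (x (Fin.castLE hn 0, 0) * x (Fin.castLE hn 1, 2) -
      x (Fin.castLE hn 1, 0) * x (Fin.castLE hn 0, 2)) := by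
  simp [beta2, del, Xe]

lemma eval_beta3 (x : Fin n × Fin 3 → ℂ) : eval x (beta3 n hn) =
    x (Fin.castLE hn 0, 2) * (x (Fin.castLE hn 0, 0) * x (Fin.castLE hn 1, 1) -
      x (Fin.castLE hn 1, 0) * x (Fin.castLE hn 0, 1)) := by
  simp [beta3, del, Xe]

lemma eval_gamma1 (x : Fin n × Fin 3 → ℂ) : eval x (gamma1 n hn) =
    x (Fin.castLE hn 0, 0) * x (Fin.castLE hn 1, 1) * x (Fin.castLE hn 2, 2) -
    x (Fin.castLE hn 0, 0) * x (Fin.castLE hn 1, 2) * x (Fin.castLE hn 2, 1) -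
    x (Fin.castLE hn 0, 1) * x (Fin.castLE hn 1, 0) * x (Fin.castLE hn 2, 2) +
    x (Fin.castLE hn 0, 1) * x (Fin.castLE hn 1, 2) * x (Fin.castLE hn 2, 0) +
    x (Fin.castLE hn 0, 2) * x (Fin.castLE hn 1, 0) * x (Fin.castLE hn 2, 1) -
    x (Fin.castLE hn 0, 2) * x (Fin.castLE hn 1, 1) * x (Fin.castLE hn 2, 0) := by
  simp [gamma1, Xe, Matrix.det_fin_three]

lemma eval_eq_eval_normalForm {f : P n} (hQ : InQ n f) (hU : UInv n f) (x : Fin n × Fin 3 → ℂ)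
    (hα : eval x (alpha1 n hn) ≠ 0) (hβ : eval x (beta3 n hn) ≠ 0)
    (hγ : eval x (gamma1 n hn) ≠ 0) :
    eval x f = eval (normalForm n (eval x (alpha1 n hn)) (eval x (beta2 n hn))
      (eval x (beta3 n hn)) (eval x (gamma1 n hn))) f := by
  rw [eval_alpha1] at hα
  rw [eval_beta3] at hβ
  rw [eval_gamma1] at hγ
  rw [eval_alpha1, eval_beta2, eval_beta3, eval_gamma1]
  obtain ⟨⟨ha, hb⟩, hc⟩ : (x (Fin.castLE hn 0, 0) ≠ 0 ∧ x (Fin.castLE hn 0, 1) ≠ 0) ∧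
      x (Fin.castLE hn 0, 2) ≠ 0 := by simpa [not_or] using hα
  have hδ := right_ne_zero_of_mul hβ
  set t : Fin 3 → ℂ := ![x (Fin.castLE hn 0, 1) * x (Fin.castLE hn 0, 2),
    (x (Fin.castLE hn 0, 1))⁻¹, (x (Fin.castLE hn 0, 2))⁻¹]
  have ht : t 0 * t 1 * t 2 = 1 := by simp [t]; field_simp
  conv_lhs => rw [← (inQ_iff n f).mp hQ t ht]
  rw [eval_scaleAct]
  symm
  set y := normalForm n _ _ _ _ with hy
  clear_value y
  refine eval_eq_of_rows hU (fun p => t p.2 * x p) y fun i => ?_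
  have hrow : ∀ k : Fin 3, i.val = k.val → i = Fin.castLE hn k := fun k h => Fin.ext h
  by_cases h0 : i.val = 0
  · obtain rfl := hrow 0 h0
    apply exists_rowcomb n hn (fun p => t p.2 * x p) _ (fun j => y (Fin.castLE hn 0, j)) 0 0 0
      (.inl rfl) (.inl rfl) (.inl rfl)
    intro j
    fin_cases j <;> simp [hy, normalForm, t] <;> field_simp
  by_cases h1 : i.val = 1
  · obtain rfl := hrow 1 h1
    apply exists_rowcomb n hn (fun p => t p.2 * x p) _ (fun j => y (Fin.castLE hn 1, j))
      (-(x (Fin.castLE hn 1, 0) / x (Fin.castLE hn 0, 0))) 0 0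
      (.inr (by simp)) (.inl rfl) (.inl rfl)
    intro j
    fin_cases j <;> simp [hy, normalForm, t] <;> field_simp <;> ring
  by_cases h2 : i.val = 2
  · obtain rfl := hrow 2 h2
    generalize hD : x (Fin.castLE hn 0, 0) * x (Fin.castLE hn 1, 1) -
      x (Fin.castLE hn 1, 0) * x (Fin.castLE hn 0, 1) = D at *
    apply exists_rowcomb n hn (fun p => t p.2 * x p) _ (fun j => y (Fin.castLE hn 2, j))
      ((x (Fin.castLE hn 1, 0) * x (Fin.castLE hn 2, 1) -
        x (Fin.castLE hn 1, 1) * x (Fin.castLE hn 2, 0)) / D)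
      ((x (Fin.castLE hn 0, 1) * x (Fin.castLE hn 2, 0) -
        x (Fin.castLE hn 0, 0) * x (Fin.castLE hn 2, 1)) / D) 0
      (.inr (by simp)) (.inr (by simp)) (.inl rfl)
    intro j
    fin_cases j <;> simp [hy, normalForm, t] <;> field_simp <;> rw [← hD] <;> ring
  · generalize hG : x (Fin.castLE hn 0, 0) * x (Fin.castLE hn 1, 1) * x (Fin.castLE hn 2, 2) -
      x (Fin.castLE hn 0, 0) * x (Fin.castLE hn 1, 2) * x (Fin.castLE hn 2, 1) -
      x (Fin.castLE hn 0, 1) * x (Fin.castLE hn 1, 0) * x (Fin.castLE hn 2, 2) +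
      x (Fin.castLE hn 0, 1) * x (Fin.castLE hn 1, 2) * x (Fin.castLE hn 2, 0) +
      x (Fin.castLE hn 0, 2) * x (Fin.castLE hn 1, 0) * x (Fin.castLE hn 2, 1) -
      x (Fin.castLE hn 0, 2) * x (Fin.castLE hn 1, 1) * x (Fin.castLE hn 2, 0) = G at *
    apply exists_rowcomb n hn (fun p => t p.2 * x p) _ (fun j => y (i, j))
      (-((x (i, 0) * (x (Fin.castLE hn 1, 1) * x (Fin.castLE hn 2, 2) -
          x (Fin.castLE hn 1, 2) * x (Fin.castLE hn 2, 1)) +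
        x (i, 1) * (x (Fin.castLE hn 1, 2) * x (Fin.castLE hn 2, 0) -
          x (Fin.castLE hn 1, 0) * x (Fin.castLE hn 2, 2)) +
        x (i, 2) * (x (Fin.castLE hn 1, 0) * x (Fin.castLE hn 2, 1) -
          x (Fin.castLE hn 1, 1) * x (Fin.castLE hn 2, 0))) / G))
      (-((x (i, 0) * (x (Fin.castLE hn 2, 1) * x (Fin.castLE hn 0, 2) -
          x (Fin.castLE hn 2, 2) * x (Fin.castLE hn 0, 1)) +
        x (i, 1) * (x (Fin.castLE hn 2, 2) * x (Fin.castLE hn 0, 0) -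
          x (Fin.castLE hn 2, 0) * x (Fin.castLE hn 0, 2)) +
        x (i, 2) * (x (Fin.castLE hn 2, 0) * x (Fin.castLE hn 0, 1) -
          x (Fin.castLE hn 2, 1) * x (Fin.castLE hn 0, 0))) / G))
      (-((x (i, 0) * (x (Fin.castLE hn 0, 1) * x (Fin.castLE hn 1, 2) -
          x (Fin.castLE hn 0, 2) * x (Fin.castLE hn 1, 1)) +
        x (i, 1) * (x (Fin.castLE hn 0, 2) * x (Fin.castLE hn 1, 0) -
          x (Fin.castLE hn 0, 0) * x (Fin.castLE hn 1, 2)) +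
        x (i, 2) * (x (Fin.castLE hn 0, 0) * x (Fin.castLE hn 1, 1) -
          x (Fin.castLE hn 0, 1) * x (Fin.castLE hn 1, 0))) / G))
      (.inr (by lia)) (.inr (by lia)) (.inr (by lia))
    intro j
    fin_cases j <;> simp [hy, normalForm, t, h0, h1, h2] <;> field_simp <;> rw [← hG] <;> ring

lemma eval_normalForm (a b₂ b₃ c : ℂ) (ha : a ≠ 0) (hb : b₃ ≠ 0) :
    eval (normalForm n a b₂ b₃ c) (alpha1 n hn) = a ∧
    eval (normalForm n a b₂ b₃ c) (beta2 n hn) = b₂ ∧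
    eval (normalForm n a b₂ b₃ c) (beta3 n hn) = b₃ ∧
    eval (normalForm n a b₂ b₃ c) (gamma1 n hn) = c := by
  rw [eval_alpha1, eval_beta2, eval_beta3, eval_gamma1]
  refine ⟨?_, ?_, ?_, ?_⟩ <;> simp [normalForm] <;> field_simp

/-- Two polynomials agreeing off the zero locus of a nonzero polynomial are equal. -/
lemma eq_of_eval_eq {σ : Type*} {p q h : MvPolynomial σ ℂ} (hh : h ≠ 0)
    (H : ∀ x, eval x h ≠ 0 → eval x p = eval x q) : p = q := by
  have : h * (p - q) = 0 := by
    apply MvPolynomial.funext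
    intro x
    by_cases hx : eval x h = 0
    · simp [hx]
    · simp [H x hx]
  exact sub_eq_zero.mp ((mul_eq_zero.mp this).resolve_left hh)

lemma exists_clear_denom {σ τ : Type*} (a : σ → MvPolynomial τ ℂ) (d : MvPolynomial τ ℂ)
    (f : MvPolynomial σ ℂ) : ∃ (N : ℕ) (A : MvPolynomial τ ℂ), ∀ y, eval y d ≠ 0 →
      eval y A = eval y d ^ N * eval (fun i => eval y (a i) / eval y d) f := by
  induction f using MvPolynomial.induction_on with
  | C r => exact ⟨0, C r, fun y _ => by simp⟩
  | add p q hp hq =>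
    obtain ⟨N, A, hA⟩ := hp
    obtain ⟨M, B, hB⟩ := hq
    refine ⟨N + M, d ^ M * A + d ^ N * B, fun y hy => ?_⟩
    simp only [map_add, map_mul, map_pow, hA y hy, hB y hy]
    ring
  | mul_X p i hp =>
    obtain ⟨N, A, hA⟩ := hp
    refine ⟨N + 1, A * a i, fun y hy => ?_⟩
    simp only [map_mul, eval_X, hA y hy]
    field_simp
    ring

/-- The polynomials `α₁, β₂, β₃, γ₁`. -/
def coords : Fin 4 → P n := ![alpha1 n hn, beta2 n hn, beta3 n hn, gamma1 n hn]

lemma eval_aeval_coords (x : Fin n × Fin 3 → ℂ) (A : MvPolynomial (Fin 4) ℂ) :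
    eval x (aeval (coords n hn) A) = eval (fun k => eval x (coords n hn k)) A := by
  induction A using MvPolynomial.induction_on with
  | C a => simp
  | add p q hp hq => rw [map_add, map_add, map_add, hp, hq]
  | mul_X p i hp => rw [map_mul, map_mul, map_mul, hp, aeval_X, eval_X]

lemma eval_coords_normalForm (y : Fin 4 → ℂ) (h0 : y 0 ≠ 0) (h2 : y 2 ≠ 0) :
    (fun k => eval (normalForm n (y 0) (y 1) (y 2) (y 3)) (coords n hn k)) = y := by
  obtain ⟨h₁, h₂, h₃, h₄⟩ := eval_normalForm n hn (y 0) (y 1) (y 2) (y 3) h0 h2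
  funext k
  fin_cases k
  exacts [h₁, h₂, h₃, h₄]

/-- `α₁, β₂, β₃, γ₁` are algebraically independent. -/
lemma aeval_coords_injective : Function.Injective (aeval (R := ℂ) (coords n hn)) := by
  intro A B h
  refine eq_of_eval_eq (h := X 0 * X 2) (mul_ne_zero (X_ne_zero _) (X_ne_zero _)) fun y hy => ?_
  obtain ⟨h0, h2⟩ : y 0 ≠ 0 ∧ y 2 ≠ 0 := by simpa [not_or] using hy
  have := congrArg (eval (normalForm n (y 0) (y 1) (y 2) (y 3))) h
  rwa [eval_aeval_coords, eval_aeval_coords, eval_coords_normalForm n hn y h0 h2] at this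

lemma coords_ne_zero (k : Fin 4) : coords n hn k ≠ 0 := by
  intro h
  refine X_ne_zero (R := ℂ) k (aeval_coords_injective n hn ?_)
  rw [aeval_X, h, map_zero]

lemma exists_mul_eq_aeval {f : P n} (hQ : InQ n f) (hU : UInv n f) :
    ∃ (N : ℕ) (A : MvPolynomial (Fin 4) ℂ),
      (alpha1 n hn * beta3 n hn) ^ N * f = aeval (coords n hn) A := by
  let num : Fin n × Fin 3 → MvPolynomial (Fin 4) ℂ := fun p =>
    if p.1.val = 0 then ![X 0 ^ 2 * X 2, X 0 * X 2, X 0 * X 2] p.2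
    else if p.1.val = 1 then ![0, X 2 ^ 2, X 1 * X 2] p.2
    else if p.1.val = 2 then ![0, 0, X 3 * X 0] p.2
    else 0
  obtain ⟨N, A, hA⟩ := exists_clear_denom num (X 0 * X 2) f
  have h0 := coords_ne_zero n hn 0
  have h2 := coords_ne_zero n hn 2
  have h3 := coords_ne_zero n hn 3
  refine ⟨N, A, eq_of_eval_eq (mul_ne_zero (mul_ne_zero h0 h2) h3) fun x hx => ?_⟩
  obtain ⟨⟨hx0, hx2⟩, hx3⟩ : (eval x (coords n hn 0) ≠ 0 ∧ eval x (coords n hn 2) ≠ 0) ∧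
      eval x (coords n hn 3) ≠ 0 := by simpa [not_or] using hx
  rw [eval_aeval_coords, hA _ (by simpa using ⟨hx0, hx2⟩), map_mul,
    eval_eq_eval_normalForm n hn hQ hU x hx0 hx2 hx3]
  congr 1
  · simp [coords]
  · congr 2
    funext ⟨i, j⟩
    simp only [normalForm, num]
    change eval x (alpha1 n hn) ≠ 0 at hx0
    change eval x (beta3 n hn) ≠ 0 at hx2
    split_ifs <;> fin_cases j <;> simp [coords] <;> field_simp

end
section
variable (n : ℕ) (hn : 3 ≤ n)

lemma permAct_Xe (σ : Equiv.Perm (Fin 3)) (i j : Fin 3) :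
    permAct n σ (Xe n hn i j) = Xe n hn i (σ j) := by
  simp [permAct, Xe]

/-- `β₂ − β₃ = x₁₁ δ₂₃`. -/
lemma beta2_sub_beta3 : beta2 n hn - beta3 n hn = Xe n hn 0 0 * del n hn 1 2 := by
  simp only [beta2, beta3, del]; ring

lemma beta_mul_beta_mul_sub :
    beta2 n hn * beta3 n hn * (beta2 n hn - beta3 n hn) = alpha1 n hn * gamma2 n hn := by
  rw [beta2_sub_beta3]; simp only [beta2, beta3, alpha1, gamma2]; ring

lemma alpha3_sq : alpha3 n hn ^ 2 =
    4 * alpha2 n hn ^ 3 - 27 * (alpha1 n hn ^ 2 * gamma2 n hn ^ 2) := by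
  rw [← mul_pow, ← beta_mul_beta_mul_sub, alpha2, alpha3]; ring

lemma permAct_swap :
    permAct n (Equiv.swap 1 2) (alpha1 n hn) = alpha1 n hn ∧
    permAct n (Equiv.swap 1 2) (beta2 n hn) = beta3 n hn ∧
    permAct n (Equiv.swap 1 2) (beta3 n hn) = beta2 n hn ∧
    permAct n (Equiv.swap 1 2) (gamma1 n hn) = -gamma1 n hn ∧
    permAct n (Equiv.swap 1 2) (gamma2 n hn) = -gamma2 n hn := by
  have h0 : Equiv.swap (1 : Fin 3) 2 0 = 0 := by decide
  have h1 : Equiv.swap (1 : Fin 3) 2 1 = 2 := by decide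
  have h2 : Equiv.swap (1 : Fin 3) 2 2 = 1 := by decide
  refine ⟨?_, ?_, ?_, ?_, ?_⟩ <;>
    simp only [alpha1, beta2, beta3, gamma1, gamma2, del, Matrix.det_fin_three, Matrix.of_apply,
      map_mul, map_sub, map_add, permAct_Xe, h0, h1, h2] <;> ring

lemma permAct_rotate :
    permAct n (finRotate 3) (alpha1 n hn) = alpha1 n hn ∧
    permAct n (finRotate 3) (beta2 n hn) = -beta3 n hn ∧
    permAct n (finRotate 3) (beta3 n hn) = beta2 n hn - beta3 n hn ∧
    permAct n (finRotate 3) (gamma1 n hn) = gamma1 n hn ∧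
    permAct n (finRotate 3) (gamma2 n hn) = gamma2 n hn := by
  have h0 : finRotate 3 0 = 1 := by decide
  have h1 : finRotate 3 1 = 2 := by decide
  have h2 : finRotate 3 2 = 0 := by decide
  refine ⟨?_, ?_, ?_, ?_, ?_⟩ <;>
    simp only [alpha1, beta2, beta3, gamma1, gamma2, del, Matrix.det_fin_three, Matrix.of_apply,
      map_mul, map_sub, map_add, permAct_Xe, h0, h1, h2] <;> ring

/-- Clearing only `α₁` suffices: by the symmetry exchanging `β₂` and `β₃`, the power of `β₃` in the
denominator can be removed. -/
lemma exists_alpha1_pow_mul_eq_aeval {f : P n} (hQ : InQ n f) (hU : UInv n f)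
    (hS : permAct n (Equiv.swap 1 2) f = f) :
    ∃ (N : ℕ) (A : MvPolynomial (Fin 4) ℂ), alpha1 n hn ^ N * f = aeval (coords n hn) A := by
  obtain ⟨N, A, hA⟩ := exists_mul_eq_aeval n hn hQ hU
  obtain ⟨p1, p2, p3, p4, -⟩ := permAct_swap n hn
  have hcomp : (permAct n (Equiv.swap 1 2)).comp (aeval (coords n hn)) =
      (aeval (coords n hn)).comp (aeval (![X 0, X 2, X 1, -X 3] : Fin 4 → MvPolynomial (Fin 4) ℂ)) := by
    apply MvPolynomial.algHom_ext
    intro i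
    fin_cases i
    · simpa [coords] using p1
    · simpa [coords] using p2
    · simpa [coords] using p3
    · simpa [coords] using p4
  set B := aeval (![X 0, X 2, X 1, -X 3] : Fin 4 → MvPolynomial (Fin 4) ℂ) A with hB
  have hA' : (alpha1 n hn * beta2 n hn) ^ N * f = aeval (coords n hn) B := by
    have := congrArg (permAct n (Equiv.swap 1 2)) hA
    rw [map_mul, map_pow, map_mul, p1, p3, hS] at this
    rw [this, hB]
    exact DFunLike.congr_fun hcomp A
  have hc1 : aeval (coords n hn) (X 1 : MvPolynomial (Fin 4) ℂ) = beta2 n hn := by simp [coords]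
  have hc2 : aeval (coords n hn) (X 2 : MvPolynomial (Fin 4) ℂ) = beta3 n hn := by simp [coords]
  have hAB : X 1 ^ N * A = X 2 ^ N * B := by
    apply aeval_coords_injective n hn
    rw [map_mul, map_mul, map_pow, map_pow, ← hA, ← hA', hc1, hc2]
    ring
  have hprime : Prime (X 2 : MvPolynomial (Fin 4) ℂ) := X_prime
  have hdvd : (X 2 : MvPolynomial (Fin 4) ℂ) ^ N ∣ A := by
    refine hprime.pow_dvd_of_dvd_mul_left N (fun h => ?_) (Dvd.intro _ hAB.symm)
    obtain ⟨q, hq⟩ := hprime.dvd_of_dvd_pow h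
    have := congrArg (eval (fun i : Fin 4 => if i = 1 then (1 : ℂ) else 0)) hq
    simp at this
  obtain ⟨A', rfl⟩ := hdvd
  refine ⟨N, A', mul_left_cancel₀ (pow_ne_zero N (coords_ne_zero n hn 2)) ?_⟩
  rw [map_mul, map_pow, hc2, mul_pow] at hA
  change beta3 n hn ^ N * _ = beta3 n hn ^ N * _
  rw [← hA]
  ring

/-- The polynomials `α₁, α₂, α₃, γ₁, γ₂`. -/
def gens : Fin 5 → P n := ![alpha1 n hn, alpha2 n hn, alpha3 n hn, gamma1 n hn, gamma2 n hn]

lemma gens_mem_range (k : Fin 5) : gens n hn k ∈ (aeval (R := ℂ) (gens n hn)).range :=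
  ⟨X k, by simp⟩

lemma permAct_rotate_of_mem_range {a : P n} (ha : a ∈ (aeval (R := ℂ) (gens n hn)).range) :
    permAct n (finRotate 3) a = a := by
  obtain ⟨q, rfl⟩ := ha
  obtain ⟨p1, p2, p3, p4, p5⟩ := permAct_rotate n hn
  have : (permAct n (finRotate 3)).comp (aeval (gens n hn)) = aeval (R := ℂ) (gens n hn) := by
    apply MvPolynomial.algHom_ext
    intro i
    fin_cases i
    · simpa [gens] using p1
    · simp [gens, alpha2, p2, p3]; ring
    · simp [gens, alpha3, p2, p3, map_ofNat (permAct n (finRotate 3))]; ring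
    · simpa [gens] using p4
    · simpa [gens] using p5
  exact DFunLike.congr_fun this q

/-- A polynomial in `α₁, β₂, β₃, γ₁` fixed by the cyclic column permutation is a polynomial in
`α₁, α₂, α₃, γ₁, γ₂`. -/
lemma mem_range_of_rotate_fixed (A : MvPolynomial (Fin 4) ℂ)
    (hA : permAct n (finRotate 3) (aeval (coords n hn) A) = aeval (coords n hn) A) :
    aeval (coords n hn) A ∈ (aeval (R := ℂ) (gens n hn)).range := by
  set S := (aeval (R := ℂ) (gens n hn)).range with hS
  have g0 : alpha1 n hn ∈ S := gens_mem_range n hn 0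
  have g1 : alpha2 n hn ∈ S := gens_mem_range n hn 1
  have g2 : alpha3 n hn ∈ S := gens_mem_range n hn 2
  have g3 : gamma1 n hn ∈ S := gens_mem_range n hn 3
  have g4 : gamma2 n hn ∈ S := gens_mem_range n hn 4
  obtain ⟨ω, hω⟩ : ∃ ω : ℂ, ω ^ 2 + ω + 1 = 0 := by
    obtain ⟨s, hs⟩ := IsAlgClosed.exists_pow_nat_eq (-3 : ℂ) (n := 2) two_pos
    exact ⟨(-1 + s) / 2, by linear_combination hs / 4⟩
  have hCS : ∀ r : ℂ, (C r : P n) ∈ S := fun r => S.algebraMap_mem r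
  have hw : (C ω : P n) ^ 2 + C ω + 1 = 0 := by
    rw [← C_pow, ← C_add, ← C_1, ← C_add, hω, C_0]
  have hwρ : permAct n (finRotate 3) (C ω) = C ω := (permAct n (finRotate 3)).commutes ω
  set w : P n := C ω
  set u := w * beta2 n hn + w ^ 2 * beta3 n hn with hu
  set v := w ^ 2 * beta2 n hn + w * beta3 n hn with hv
  have huv : u * v = alpha2 n hn := by
    rw [hu, hv, alpha2]
    linear_combination (
      w ^ 2 * beta2 n hn * beta3 n hn + w * beta2 n hn ^ 2 + w * beta3 n hn ^ 2 - w * beta2 n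
      hn * beta3 n hn - beta2 n hn ^ 2 - beta3 n hn ^ 2 + beta2 n hn * beta3 n hn) * hw
  have h2 : (C (1 / 2 : ℂ) : P n) * 2 = 1 := by
    rw [show (2 : P n) = C 2 from (map_ofNat C 2).symm, ← C_mul]; norm_num
  have h3 : (C (1 / 3 : ℂ) : P n) * 3 = 1 := by
    rw [show (3 : P n) = C 3 from (map_ofNat C 3).symm, ← C_mul]; norm_num
  have hu3 : u ^ 3 ∈ S := by
    have : u ^ 3 = C (1 / 2) * (alpha3 n hn + 3 * (2 * w + 1) * (alpha1 n hn * gamma2 n hn)) := by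
      rw [← beta_mul_beta_mul_sub]
      rw [alpha3, hu]
      linear_combination (-(w * beta2 n hn + w ^ 2 * beta3 n hn) ^ 3) * h2 + C (1 / 2 : ℂ) * (
      2 * w ^ 4 * beta3 n hn ^ 3 + 6 * w ^ 3 * beta2 n hn * beta3 n hn ^ 2 - 2 * w ^ 3 * beta3
      n hn ^ 3 + 6 * w ^ 2 * beta2 n hn ^ 2 * beta3 n hn - 6 * w ^ 2 * beta2 n hn * beta3 n hn
      ^ 2 + 2 * w * beta2 n hn ^ 3 + 2 * w * beta3 n hn ^ 3 - 6 * w * beta2 n hn ^ 2 * beta3 n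
      hn + 6 * beta2 n hn * beta3 n hn ^ 2 - 2 * beta2 n hn ^ 3 - 2 * beta3 n hn ^ 3) * hw
    rw [this]
    exact S.mul_mem (hCS _) (S.add_mem g2 (S.mul_mem (S.mul_mem (S.natCast_mem 3)
      (S.add_mem (S.mul_mem (S.natCast_mem 2) (hCS _)) S.one_mem)) (S.mul_mem g0 g4)))
  have hv3 : v ^ 3 ∈ S := by
    have : v ^ 3 = alpha3 n hn - u ^ 3 := by
      rw [alpha3, hu, hv]
      linear_combination (
      w ^ 4 * beta2 n hn ^ 3 + w ^ 4 * beta3 n hn ^ 3 + 3 * w ^ 3 * beta2 n hn ^ 2 * beta3 n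
      hn + 3 * w ^ 3 * beta2 n hn * beta3 n hn ^ 2 - w ^ 3 * beta2 n hn ^ 3 - w ^ 3 * beta3 n
      hn ^ 3 + 2 * w * beta3 n hn ^ 3 + 2 * w * beta2 n hn ^ 3 - 3 * w * beta2 n hn ^ 2 *
      beta3 n hn - 3 * w * beta2 n hn * beta3 n hn ^ 2 - 2 * beta3 n hn ^ 3 - 2 * beta2 n hn ^
      3 + 3 * beta2 n hn ^ 2 * beta3 n hn + 3 * beta2 n hn * beta3 n hn ^ 2) * hw
    rw [this]
    exact S.sub_mem g2 hu3
  obtain ⟨p1, p2, p3, p4, p5⟩ := permAct_rotate n hn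
  have hρu : permAct n (finRotate 3) u = w * u := by
    rw [hu, map_add, map_mul, map_mul, map_pow, hwρ, p2, p3]
    linear_combination (-(w * beta3 n hn)) * hw
  have hρv : permAct n (finRotate 3) v = w ^ 2 * v := by
    rw [hv, map_add, map_mul, map_mul, map_pow, hwρ, p2, p3]
    linear_combination (
      -w ^ 2 * beta2 n hn - w * beta3 n hn + w * beta2 n hn) * hw
  let E : P n → Prop := fun h => ∃ a₀ ∈ S, ∃ a₁ ∈ S, ∃ a₂ ∈ S, ∃ b₁ ∈ S, ∃ b₂ ∈ S,
    h = a₀ + a₁ * u + a₂ * u ^ 2 + b₁ * v + b₂ * v ^ 2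
  have Eadd : ∀ h k, E h → E k → E (h + k) := by
    rintro _ _ ⟨a₀, h0, a₁, h1, a₂, h2, b₁, h3, b₂, h4, rfl⟩
      ⟨a₀', h0', a₁', h1', a₂', h2', b₁', h3', b₂', h4', rfl⟩
    exact ⟨_, S.add_mem h0 h0', _, S.add_mem h1 h1', _, S.add_mem h2 h2', _, S.add_mem h3 h3',
      _, S.add_mem h4 h4', by ring⟩
  have Esmul : ∀ s ∈ S, ∀ h, E h → E (s * h) := by
    rintro s hs _ ⟨a₀, h0, a₁, h1, a₂, h2, b₁, h3, b₂, h4, rfl⟩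
    exact ⟨_, S.mul_mem hs h0, _, S.mul_mem hs h1, _, S.mul_mem hs h2, _, S.mul_mem hs h3,
      _, S.mul_mem hs h4, by ring⟩
  have Eu : ∀ h, E h → E (h * u) := by
    rintro _ ⟨a₀, h0, a₁, h1, a₂, h2, b₁, h3, b₂, h4, rfl⟩
    exact ⟨_, S.add_mem (S.mul_mem h2 hu3) (S.mul_mem h3 g1), _, h0, _, h1, _, S.mul_mem h4 g1,
      _, S.zero_mem, by rw [← huv]; ring⟩
  have Ev : ∀ h, E h → E (h * v) := by
    rintro _ ⟨a₀, h0, a₁, h1, a₂, h2, b₁, h3, b₂, h4, rfl⟩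
    exact ⟨_, S.add_mem (S.mul_mem h4 hv3) (S.mul_mem h1 g1), _, S.mul_mem h2 g1,
      _, S.zero_mem, _, h0, _, h3, by rw [← huv]; ring⟩
  have hβ2 : beta2 n hn = C (1 / 3) * (w ^ 2 - 1) * u + C (1 / 3) * (w - 1) * v := by
    rw [hu, hv]
    linear_combination (-beta2 n hn) * h3 + C (1 / 3 : ℂ) * (
      -w ^ 2 * beta3 n hn - 2 * w * beta2 n hn + w * beta3 n hn + 3 * beta2 n hn) * hw
  have hβ3 : beta3 n hn = C (1 / 3) * (w - 1) * u + C (1 / 3) * (w ^ 2 - 1) * v := by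
    rw [hu, hv]
    linear_combination (-beta3 n hn) * h3 + C (1 / 3 : ℂ) * (
      -w ^ 2 * beta2 n hn - 2 * w * beta3 n hn + w * beta2 n hn + 3 * beta3 n hn) * hw
  have m1 : C (1 / 3) * (w ^ 2 - 1) ∈ S :=
    S.mul_mem (hCS _) (S.sub_mem (S.pow_mem (hCS _) 2) S.one_mem)
  have m2 : C (1 / 3) * (w - 1) ∈ S := S.mul_mem (hCS _) (S.sub_mem (hCS _) S.one_mem)
  have Eall : ∀ p : MvPolynomial (Fin 4) ℂ, E (aeval (coords n hn) p) := by
    intro p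
    induction p using MvPolynomial.induction_on with
    | C a => exact ⟨_, S.algebraMap_mem a, 0, S.zero_mem, 0, S.zero_mem, 0, S.zero_mem,
        0, S.zero_mem, by simp⟩
    | add p q hp hq => rw [map_add]; exact Eadd _ _ hp hq
    | mul_X p i hp =>
      rw [map_mul, aeval_X]
      fin_cases i
      · rw [mul_comm]; exact Esmul _ g0 _ hp
      · have : aeval (coords n hn) p * beta2 n hn =
            C (1 / 3) * (w ^ 2 - 1) * (aeval (coords n hn) p * u) +
            C (1 / 3) * (w - 1) * (aeval (coords n hn) p * v) := by
          conv_lhs => rw [hβ2]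
          ring
        exact this ▸ Eadd _ _ (Esmul _ m1 _ (Eu _ hp)) (Esmul _ m2 _ (Ev _ hp))
      · have : aeval (coords n hn) p * beta3 n hn =
            C (1 / 3) * (w - 1) * (aeval (coords n hn) p * u) +
            C (1 / 3) * (w ^ 2 - 1) * (aeval (coords n hn) p * v) := by
          conv_lhs => rw [hβ3]
          ring
        exact this ▸ Eadd _ _ (Esmul _ m2 _ (Eu _ hp)) (Esmul _ m1 _ (Ev _ hp))
      · rw [mul_comm]; exact Esmul _ g3 _ hp
  obtain ⟨a₀, h0, a₁, h1, a₂, h2', b₁, h3', b₂, h4, hE⟩ := Eall A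
  have r1 := hA
  rw [hE] at r1
  simp only [map_add, map_mul, map_pow, hρu, hρv, permAct_rotate_of_mem_range n hn h0,
    permAct_rotate_of_mem_range n hn h1, permAct_rotate_of_mem_range n hn h2',
    permAct_rotate_of_mem_range n hn h3', permAct_rotate_of_mem_range n hn h4] at r1
  have r2 := congrArg (permAct n (finRotate 3)) r1
  simp only [map_add, map_mul, map_pow, hρu, hρv, hwρ, permAct_rotate_of_mem_range n hn h0,
    permAct_rotate_of_mem_range n hn h1, permAct_rotate_of_mem_range n hn h2',
    permAct_rotate_of_mem_range n hn h3', permAct_rotate_of_mem_range n hn h4] at r2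
  have : aeval (coords n hn) A = a₀ := by
    rw [hE]
    linear_combination (-(a₁ * u + a₂ * u ^ 2 + b₁ * v + b₂ * v ^ 2)) * h3 +
      C (1 / 3 : ℂ) * (
      b₂ * v ^ 2 * w ^ 6 - b₂ * v ^ 2 * w ^ 5 + b₂ * v ^ 2 * w ^ 3 + a₂ * u ^ 2 * w ^ 2 + b₁ *
      v * w ^ 2 - b₂ * v ^ 2 * w - a₂ * u ^ 2 * w - b₁ * v * w + a₁ * u + b₂ * v ^ 2 + a₂ * u
      ^ 2 + b₁ * v) * hw - C (1 / 3 : ℂ) * (2 * r1 + r2)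
  rw [this]
  exact h0
end

section
variable {R R' ι : Type*} [CommRing R] [CommRing R'] [Algebra ℂ R] [Algebra ℂ R']
  (φ : R →ₐ[ℂ] R') {t : R} {v : ι → R}

/-- If `φ` kills `t` and keeps the family `v` independent, then the products of powers of `t` with
members of `v` are independent. -/
lemma linearIndependent_pow_mul [IsDomain R] (ht : t ≠ 0) (hφ : φ t = 0)
    (hv : LinearIndependent ℂ (fun i => φ (v i))) :
    LinearIndependent ℂ (fun p : ℕ × ι => t ^ p.1 * v p.2) := by
  classical
  rw [linearIndependent_iff']
  intro s g hg
  have key : ∀ a, ∀ i ∈ s, i.1 = a → g i = 0 := by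
    intro a
    induction a using Nat.strong_induction_on with
    | _ a ih =>
      have h1 : t ^ a * ∑ i ∈ s, g i • (t ^ (i.1 - a) * v i.2) = 0 := by
        rw [← hg, Finset.mul_sum]
        refine Finset.sum_congr rfl fun i hi => ?_
        rcases lt_or_ge i.1 a with h | h
        · simp [ih _ h i hi rfl]
        · rw [mul_smul_comm, ← mul_assoc, ← pow_add, Nat.add_sub_cancel' h]
      have h2 := congrArg φ ((mul_eq_zero.mp h1).resolve_left (pow_ne_zero a ht))
      rw [map_sum, map_zero] at h2
      have h3 : ∑ j ∈ (s.filter (fun i => i.1 = a)).image Prod.snd, g (a, j) • φ (v j) = 0 := by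
        rw [Finset.sum_image, ← h2, Finset.sum_filter]
        · refine Finset.sum_congr rfl fun i hi => ?_
          rcases lt_trichotomy i.1 a with h | h | h
          · simp [ih _ h i hi rfl, h.ne]
          · subst h; simp
          · rw [if_neg h.ne', map_smul, map_mul, map_pow, hφ,
              zero_pow (Nat.sub_ne_zero_of_lt h), zero_mul, smul_zero]
        · intro i hi j hj hij
          simp only [Finset.coe_filter, Set.mem_ofPred_eq] at hi hj
          exact Prod.ext (hi.2.trans hj.2.symm) hij
      rintro ⟨b, j⟩ hi rfl
      exact linearIndependent_iff'.mp hv _ (fun j => g (b, j)) h3 j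
        (Finset.mem_image.mpr ⟨(b, j), Finset.mem_filter.mpr ⟨hi, rfl⟩, rfl⟩)
  exact fun i hi => key i.1 i hi rfl

lemma mem_span_of_mul_mem_span [IsDomain R] (ht : t ≠ 0) (hφ : φ t = 0)
    (hv : LinearIndependent ℂ (fun i => φ (v i))) {f : R}
    (hf : t * f ∈ Submodule.span ℂ (Set.range fun p : ℕ × ι => t ^ p.1 * v p.2)) :
    f ∈ Submodule.span ℂ (Set.range fun p : ℕ × ι => t ^ p.1 * v p.2) := by
  set W := Submodule.span ℂ (Set.range fun p : ℕ × ι => t ^ p.1 * v p.2)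
  have key : ∀ x ∈ W, ∃ c : ι →₀ ℂ, ∃ z ∈ W, x = Finsupp.linearCombination ℂ v c + t * z := by
    intro x hx
    induction hx using Submodule.span_induction with
    | mem x hx =>
      obtain ⟨⟨a, i⟩, rfl⟩ := hx
      cases a with
      | zero => exact ⟨Finsupp.single i 1, 0, W.zero_mem, by simp⟩
      | succ a => exact ⟨0, t ^ a * v i, Submodule.subset_span ⟨(a, i), rfl⟩, by simp; ring⟩
    | zero => exact ⟨0, 0, W.zero_mem, by simp⟩
    | add x y _ _ hx hy =>
      obtain ⟨c, z, hz, rfl⟩ := hx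
      obtain ⟨c', z', hz', rfl⟩ := hy
      exact ⟨c + c', z + z', W.add_mem hz hz', by rw [map_add]; ring⟩
    | smul r x _ hx =>
      obtain ⟨c, z, hz, rfl⟩ := hx
      exact ⟨r • c, r • z, W.smul_mem r hz, by rw [map_smul, smul_add, mul_smul_comm]⟩
  obtain ⟨c, z, hz, h⟩ := key _ hf
  have hc : c = 0 := by
    refine linearIndependent_iff.mp hv c ?_
    have := congrArg φ h
    rw [map_mul, map_add, map_mul, hφ, zero_mul, zero_mul, add_zero] at this
    rw [this, Finsupp.linearCombination_apply, Finsupp.linearCombination_apply, map_finsuppSum]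
    simp
  rw [hc, map_zero, zero_add] at h
  rwa [mul_left_cancel₀ ht h]
end

section
variable (n : ℕ) (hn : 3 ≤ n)

/-- Restriction to a three-parameter family of matrices on which `α₁` vanishes. -/
def toBoundary : P n →ₐ[ℂ] MvPolynomial (Fin 3) ℂ :=
  aeval fun p =>
    if p.1.val = 0 then ![0, 1, 1] p.2
    else if p.1.val = 1 then ![-X 0, 0, X 2] p.2
    else if p.1.val = 2 then ![0, 0, X 1] p.2 else 0

lemma toBoundary_gens :
    toBoundary n (alpha1 n hn) = 0 ∧ toBoundary n (alpha2 n hn) = X 0 ^ 2 ∧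
    toBoundary n (alpha3 n hn) = C (-2) * X 0 ^ 3 ∧
    toBoundary n (gamma1 n hn) = X 0 * X 1 ∧ toBoundary n (gamma2 n hn) = X 0 ^ 2 * X 2 := by
  have h0 : ∀ j, toBoundary n (Xe n hn 0 j) = ![0, 1, 1] j := fun j => by simp [toBoundary, Xe]
  have h1 : ∀ j, toBoundary n (Xe n hn 1 j) = ![-X 0, 0, X 2] j := fun j => by
    simp [toBoundary, Xe]
  have h2 : ∀ j, toBoundary n (Xe n hn 2 j) = ![0, 0, X 1] j := fun j => by simp [toBoundary, Xe]
  refine ⟨?_, ?_, ?_, ?_, ?_⟩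
  · simp [alpha1, h0]
  · simp [alpha2, beta2, beta3, del, h0, h1]
    ring
  · simp [alpha3, beta2, beta3, del, h0, h1, map_ofNat (toBoundary n), map_ofNat C]
    ring
  · simp [gamma1, Matrix.det_fin_three, h0, h1, h2]
  · simp [gamma2, del, h0, h1]
    ring

lemma linearIndependent_toBoundary :
    LinearIndependent ℂ (fun q : ℕ × Fin 2 × ℕ × ℕ × Fin 2 => toBoundary n (Binv n hn (0, q))) := by
  obtain ⟨-, p2, p3, p4, p5⟩ := toBoundary_gens n hn
  let e : ℕ × Fin 2 × ℕ × ℕ × Fin 2 → (Fin 3 →₀ ℕ) := fun q =>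
    Finsupp.equivFunOnFinite.symm ![2 * q.1 + 3 * (q.2.1 : ℕ) + (2 * q.2.2.1 + (q.2.2.2.2 : ℕ)) +
      2 * (2 * q.2.2.2.1 + (q.2.2.2.2 : ℕ)), 2 * q.2.2.1 + (q.2.2.2.2 : ℕ),
      2 * q.2.2.2.1 + (q.2.2.2.2 : ℕ)]
  have he : Function.Injective e := by
    rintro ⟨b, c, d, k, f⟩ ⟨b', c', d', k', f'⟩ h
    have h := Finsupp.equivFunOnFinite.symm.injective h
    have h0 := congrFun h 0
    have h1 := congrFun h 1
    have h2 := congrFun h 2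
    simp only [Matrix.cons_val] at h0 h1 h2
    have hc := c.isLt
    have hc' := c'.isLt
    have hf := f.isLt
    have hf' := f'.isLt
    simp only [Prod.mk.injEq, Fin.ext_iff]
    omega
  have hli : LinearIndependent ℂ (fun q => (monomial (e q) (1 : ℂ) : MvPolynomial (Fin 3) ℂ)) := by
    have := (basisMonomials (Fin 3) ℂ).linearIndependent.comp e he
    simpa [Function.comp_def] using this
  have h2 : (-2 : ℂ) ≠ 0 := by norm_num
  have := hli.units_smul (fun q => (Units.mk0 (-2 : ℂ) h2) ^ (q.2.1 : ℕ))
  convert this using 1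
  funext ⟨b, c, d, k, f⟩
  simp only [Binv, pow_zero, one_mul, map_mul, map_pow, p2, p3, p4, p5, Pi.smul_apply',
    Units.smul_def, Units.val_pow_eq_pow_val, Units.val_mk0]
  rw [monomial_eq, Finsupp.prod_fintype _ _ (fun _ => pow_zero _), Fin.prod_univ_three,
    smul_eq_C_mul, C_pow, C_1]
  simp only [e, Finsupp.equivFunOnFinite_symm_apply_apply, Matrix.cons_val]
  ring

lemma Binv_eq : Binv n hn = fun p => alpha1 n hn ^ p.1 * Binv n hn (0, p.2) := by
  funext ⟨a, b, c, d, e, f⟩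
  simp only [Binv]; ring

lemma mul_mem_span {l k : ℕ} (hlk : Even (l + k)) (c a b : ℕ) :
    alpha1 n hn ^ a * alpha2 n hn ^ b * alpha3 n hn ^ c * gamma1 n hn ^ l * gamma2 n hn ^ k ∈
      Submodule.span ℂ (Set.range (Binv n hn)) := by
  induction c using Nat.strong_induction_on generalizing a b k with
  | _ c ih =>
    rcases lt_or_ge c 2 with hc | hc
    · refine Submodule.subset_span ⟨(a, b, ⟨c, hc⟩, l / 2, k / 2, ⟨l % 2, by omega⟩), ?_⟩
      have : k % 2 = l % 2 := by rw [Nat.even_iff] at hlk; omega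
      simp only [Binv]
      rw [Nat.div_add_mod, ← this, Nat.div_add_mod]
    · obtain ⟨c, rfl⟩ := Nat.exists_eq_add_of_le' hc
      have h1 := ih c (by omega) hlk a (b + 3)
      have h2 := ih c (by omega) (k := k + 2) (by rw [← add_assoc]; exact hlk.add even_two)
        (a + 2) b
      convert Submodule.sub_mem _ (Submodule.smul_mem _ (4 : ℂ) h1)
        (Submodule.smul_mem _ (27 : ℂ) h2) using 1
      rw [pow_add (alpha3 n hn), alpha3_sq, smul_eq_C_mul, smul_eq_C_mul, map_ofNat C, map_ofNat C]
      ring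

lemma permAct_swap_alpha :
    permAct n (Equiv.swap 1 2) (alpha2 n hn) = alpha2 n hn ∧
    permAct n (Equiv.swap 1 2) (alpha3 n hn) = alpha3 n hn := by
  obtain ⟨-, p2, p3, -, -⟩ := permAct_swap n hn
  constructor
  · simp only [alpha2, map_add, map_sub, map_mul, map_pow, p2, p3]; ring
  · simp only [alpha3, map_add, map_sub, map_mul, map_pow, p2, p3,
      map_ofNat (permAct n (Equiv.swap 1 2))]
    ring

lemma mem_span_of_swap_fixed {h : P n} (hr : h ∈ (aeval (R := ℂ) (gens n hn)).range)
    (hS : permAct n (Equiv.swap 1 2) h = h) : h ∈ Submodule.span ℂ (Set.range (Binv n hn)) := by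
  set W := Submodule.span ℂ (Set.range (Binv n hn)) with hW
  obtain ⟨p1, -, -, p4, p5⟩ := permAct_swap n hn
  obtain ⟨p2, p3⟩ := permAct_swap_alpha n hn
  have key : ∀ q : MvPolynomial (Fin 5) ℂ,
      aeval (gens n hn) q + permAct n (Equiv.swap 1 2) (aeval (gens n hn) q) ∈ W := by
    intro q
    induction q using MvPolynomial.induction_on' with
    | add p q hp hq =>
      rw [map_add, map_add, add_add_add_comm]
      exact W.add_mem hp hq
    | monomial d r =>
      rw [aeval_monomial, Finsupp.prod_fintype _ _ (fun _ => pow_zero _), Fin.prod_univ_five,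
        ← Algebra.smul_def, map_smul, ← smul_add]
      apply W.smul_mem
      simp only [gens, Matrix.cons_val, map_mul, map_pow, p1, p2, p3, p4, p5]
      set u := alpha1 n hn ^ d 0 * alpha2 n hn ^ d 1 * alpha3 n hn ^ d 2 with hu
      have hsign : u * (-gamma1 n hn) ^ d 3 * (-gamma2 n hn) ^ d 4 =
          (-1) ^ (d 3 + d 4) * (u * gamma1 n hn ^ d 3 * gamma2 n hn ^ d 4) := by
        rw [neg_pow (gamma1 n hn), neg_pow (gamma2 n hn), pow_add]; ring
      rw [hsign]
      rcases Nat.even_or_odd (d 3 + d 4) with he | ho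
      · rw [he.neg_one_pow, one_mul]
        have := mul_mem_span n hn he (d 2) (d 0) (d 1)
        exact W.add_mem this this
      · rw [ho.neg_one_pow]
        convert W.zero_mem using 1
        ring
  obtain ⟨q, rfl⟩ := hr
  have h2 := W.smul_mem (1 / 2 : ℂ) (key q)
  change permAct n (Equiv.swap 1 2) (aeval (gens n hn) q) = aeval (gens n hn) q at hS
  change aeval (gens n hn) q ∈ W
  rw [hS, ← two_smul ℂ (aeval (gens n hn) q), smul_smul] at h2
  simpa using h2

lemma permAct_mul (σ τ : Equiv.Perm (Fin 3)) (f : P n) :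
    permAct n (σ * τ) f = permAct n σ (permAct n τ f) := by
  have : permAct n (σ * τ) = (permAct n σ).comp (permAct n τ) := by
    apply MvPolynomial.algHom_ext
    intro p
    simp [permAct]
  exact DFunLike.congr_fun this f

lemma permAct_one (f : P n) : permAct n 1 f = f := by
  have : permAct n 1 = AlgHom.id ℂ (P n) := by
    apply MvPolynomial.algHom_ext
    intro p
    simp [permAct]
  exact DFunLike.congr_fun this f

lemma permAct_pow {σ : Equiv.Perm (Fin 3)} {f : P n} (hf : permAct n σ f = f) (k : ℕ) :
    permAct n (σ ^ k) f = f := by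
  induction k with
  | zero => exact permAct_one n f
  | succ k ih => rw [pow_succ, permAct_mul, hf, ih]

lemma permAct_eq_self {f : P n} (hr : permAct n (finRotate 3) f = f)
    (hs : permAct n (Equiv.swap 1 2) f = f) (σ : Equiv.Perm (Fin 3)) : permAct n σ f = f := by
  have : ∀ σ : Equiv.Perm (Fin 3), ∃ a < 3, ∃ b < 2, σ = finRotate 3 ^ a * Equiv.swap 1 2 ^ b := by
    decide
  obtain ⟨a, -, b, -, rfl⟩ := this σ
  rw [permAct_mul, permAct_pow n hs, permAct_pow n hr]

lemma Binv_mem_range (p) : Binv n hn p ∈ (aeval (R := ℂ) (gens n hn)).range := by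
  obtain ⟨a, b, c, d, e, f⟩ := p
  exact mul_mem (mul_mem (mul_mem (mul_mem (pow_mem (gens_mem_range n hn 0) _)
    (pow_mem (gens_mem_range n hn 1) _)) (pow_mem (gens_mem_range n hn 2) _))
    (pow_mem (gens_mem_range n hn 3) _)) (pow_mem (gens_mem_range n hn 4) _)

lemma permAct_swap_Binv (p) : permAct n (Equiv.swap 1 2) (Binv n hn p) = Binv n hn p := by
  obtain ⟨a, b, c, d, e, f⟩ := p
  obtain ⟨p1, -, -, p4, p5⟩ := permAct_swap n hn
  obtain ⟨p2, p3⟩ := permAct_swap_alpha n hn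
  simp only [Binv, map_mul, map_pow, p1, p2, p3, p4, p5]
  rw [neg_pow (gamma1 n hn), neg_pow (gamma2 n hn), pow_add (-1 : P n), pow_add (-1 : P n),
    pow_mul (-1 : P n), pow_mul (-1 : P n), neg_one_sq, one_pow, one_pow, one_mul]
  have : ((-1 : P n) ^ (f : ℕ)) * (-1) ^ (f : ℕ) = 1 := by rw [← mul_pow]; simp
  linear_combination (alpha1 n hn ^ a * alpha2 n hn ^ b * alpha3 n hn ^ (c : ℕ) *
    gamma1 n hn ^ (2 * d + (f : ℕ)) * gamma2 n hn ^ (2 * e + (f : ℕ))) * this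

lemma scaleAct_of_mem_range {t : Fin 3 → ℂ} (ht : t 0 * t 1 * t 2 = 1) {a : P n}
    (ha : a ∈ (aeval (R := ℂ) (gens n hn)).range) : scaleAct n t a = a := by
  obtain ⟨q, rfl⟩ := ha
  have hX : ∀ i j, scaleAct n t (Xe n hn i j) = C (t j) * Xe n hn i j := fun i j => by
    simp [scaleAct, Xe]
  have hC : (C (t 0) : P n) * C (t 1) * C (t 2) = 1 := by rw [← C_mul, ← C_mul, ht, C_1]
  have p1 : scaleAct n t (alpha1 n hn) = alpha1 n hn := by
    simp only [alpha1, map_mul, hX]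
    linear_combination (Xe n hn 0 0 * Xe n hn 0 1 * Xe n hn 0 2) * hC
  have p2 : scaleAct n t (beta2 n hn) = beta2 n hn := by
    simp only [beta2, del, map_mul, map_sub, hX]
    linear_combination (Xe n hn 0 1 * (Xe n hn 0 0 * Xe n hn 1 2 - Xe n hn 1 0 * Xe n hn 0 2)) * hC
  have p3 : scaleAct n t (beta3 n hn) = beta3 n hn := by
    simp only [beta3, del, map_mul, map_sub, hX]
    linear_combination (Xe n hn 0 2 * (Xe n hn 0 0 * Xe n hn 1 1 - Xe n hn 1 0 * Xe n hn 0 1)) * hC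
  have p4 : scaleAct n t (gamma1 n hn) = gamma1 n hn := by
    simp only [gamma1, Matrix.det_fin_three, Matrix.of_apply, map_mul, map_sub, map_add, hX]
    linear_combination (
      Xe n hn 0 0 * Xe n hn 1 1 * Xe n hn 2 2 - Xe n hn 0 0 * Xe n hn 1 2 * Xe n hn 2 1 -
      Xe n hn 0 1 * Xe n hn 1 0 * Xe n hn 2 2 + Xe n hn 0 1 * Xe n hn 1 2 * Xe n hn 2 0 +
      Xe n hn 0 2 * Xe n hn 1 0 * Xe n hn 2 1 - Xe n hn 0 2 * Xe n hn 1 1 * Xe n hn 2 0) * hC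
  have p5 : scaleAct n t (gamma2 n hn) = gamma2 n hn := by
    simp only [gamma2, del, map_mul, map_sub, hX]
    linear_combination (Xe n hn 0 0 * Xe n hn 1 1 - Xe n hn 1 0 * Xe n hn 0 1) *
      (Xe n hn 0 0 * Xe n hn 1 2 - Xe n hn 1 0 * Xe n hn 0 2) *
      (Xe n hn 0 1 * Xe n hn 1 2 - Xe n hn 1 1 * Xe n hn 0 2) *
      (C (t 0) * C (t 1) * C (t 2) + 1) * hC
  have : (scaleAct n t).comp (aeval (gens n hn)) = aeval (R := ℂ) (gens n hn) := by
    apply MvPolynomial.algHom_ext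
    intro i
    fin_cases i
    · simpa [gens] using p1
    · simp [gens, alpha2, p2, p3]
    · simp [gens, alpha3, p2, p3, map_ofNat (scaleAct n t)]
    · simpa [gens] using p4
    · simpa [gens] using p5
  exact DFunLike.congr_fun this q

lemma matAct_Xe {g : Matrix (Fin n) (Fin n) ℂ} (hg : IsUpperUni n g) :
    ∃ a b c : P n, ∀ j, matAct n g (Xe n hn 0 j) = Xe n hn 0 j ∧
      matAct n g (Xe n hn 1 j) = Xe n hn 1 j + a * Xe n hn 0 j ∧
      matAct n g (Xe n hn 2 j) = Xe n hn 2 j + b * Xe n hn 0 j + c * Xe n hn 1 j := by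
  obtain ⟨m, rfl⟩ := Nat.exists_eq_add_of_le' hn
  obtain ⟨hg1, hg0⟩ := hg
  have e0 : Fin.castLE hn 0 = (0 : Fin (m + 3)) := rfl
  have e1 : Fin.castLE hn 1 = (1 : Fin (m + 3)) := rfl
  have e2 : Fin.castLE hn 2 = (2 : Fin (m + 3)) := rfl
  refine ⟨C (g 0 1), C (g 0 2), C (g 1 2), fun j => ?_⟩
  have hz : ∀ (k : Fin m) (i : Fin (m + 3)), i.val < 3 → g k.succ.succ.succ i = 0 := fun k i hi =>
    hg0 _ _ (by rw [Fin.lt_def]; simp; omega)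
  have f1 : Fin.succ (0 : Fin (m + 2)) = 1 := rfl
  have f2 : Fin.succ (Fin.succ (0 : Fin (m + 1))) = 2 := rfl
  have v1 : ((1 : Fin (m + 3)) : ℕ) = 1 := rfl
  have v2 : ((2 : Fin (m + 3)) : ℕ) = 2 := rfl
  simp only [matAct, Xe, e0, e1, e2, aeval_X, Fin.sum_univ_succ, f2, f1]
  refine ⟨?_, ?_, ?_⟩
  · rw [Finset.sum_eq_zero fun k _ => by rw [hz k 0 (by simp)]; simp, hg1,
      hg0 1 0 (by rw [Fin.lt_def, v1]; simp), hg0 2 0 (by rw [Fin.lt_def, v2]; simp)]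
    simp
  · rw [Finset.sum_eq_zero fun k _ => by rw [hz k 1 (by omega)]; simp, hg1,
      hg0 2 1 (by rw [Fin.lt_def, v1, v2]; simp)]
    simp; ring
  · rw [Finset.sum_eq_zero fun k _ => by rw [hz k 2 (by omega)]; simp, hg1]
    simp; ring

lemma matAct_of_mem_range {g : Matrix (Fin n) (Fin n) ℂ} (hg : IsUpperUni n g) {f : P n}
    (hf : f ∈ (aeval (R := ℂ) (gens n hn)).range) : matAct n g f = f := by
  obtain ⟨q, rfl⟩ := hf
  obtain ⟨a, b, c, hX⟩ := matAct_Xe n hn hg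
  have h0 := fun j => (hX j).1
  have h1 := fun j => (hX j).2.1
  have h2 := fun j => (hX j).2.2
  have hdel : ∀ i j, matAct n g (del n hn i j) = del n hn i j := fun i j => by
    simp only [del, map_mul, map_sub, h0, h1]; ring
  have p1 : matAct n g (alpha1 n hn) = alpha1 n hn := by simp only [alpha1, map_mul, h0]
  have p2 : matAct n g (beta2 n hn) = beta2 n hn := by simp only [beta2, map_mul, h0, hdel]
  have p3 : matAct n g (beta3 n hn) = beta3 n hn := by simp only [beta3, map_mul, h0, hdel]
  have p4 : matAct n g (gamma1 n hn) = gamma1 n hn := by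
    simp only [gamma1, Matrix.det_fin_three, Matrix.of_apply, map_mul, map_sub, map_add, h0, h1, h2]
    ring
  have p5 : matAct n g (gamma2 n hn) = gamma2 n hn := by simp only [gamma2, map_mul, hdel]
  have : (matAct n g).comp (aeval (gens n hn)) = aeval (R := ℂ) (gens n hn) := by
    apply MvPolynomial.algHom_ext
    intro i
    fin_cases i
    · simpa [gens] using p1
    · simp [gens, alpha2, p2, p3]
    · simp [gens, alpha3, p2, p3, map_ofNat (matAct n g)]
    · simpa [gens] using p4
    · simpa [gens] using p5
  exact DFunLike.congr_fun this q

lemma mem_span_of_invariant {f : P n} (hQ : InQ n f)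
    (hS : ∀ σ : Equiv.Perm (Fin 3), permAct n σ f = f) (hU : UInv n f) :
    f ∈ Submodule.span ℂ (Set.range (Binv n hn)) := by
  obtain ⟨N, A, hA⟩ := exists_alpha1_pow_mul_eq_aeval n hn hQ hU (hS _)
  have hmem : alpha1 n hn ^ N * f ∈ Submodule.span ℂ (Set.range (Binv n hn)) := by
    refine mem_span_of_swap_fixed n hn ?_ ?_
    · rw [hA]
      refine mem_range_of_rotate_fixed n hn A ?_
      rw [← hA, map_mul, map_pow, (permAct_rotate n hn).1, hS]
    · rw [map_mul, map_pow, (permAct_swap n hn).1, hS]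
  clear hA
  induction N with
  | zero => simpa using hmem
  | succ N ih =>
    apply ih
    rw [pow_succ', mul_assoc] at hmem
    rw [Binv_eq] at hmem ⊢
    exact mem_span_of_mul_mem_span (toBoundary n) (coords_ne_zero n hn 0) (toBoundary_gens n hn).1
      (linearIndependent_toBoundary n hn) hmem

lemma invariant_of_mem_span {f : P n} (hf : f ∈ Submodule.span ℂ (Set.range (Binv n hn))) :
    InQ n f ∧ (∀ σ : Equiv.Perm (Fin 3), permAct n σ f = f) ∧ UInv n f := by
  have hr : f ∈ (aeval (R := ℂ) (gens n hn)).range := by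
    have : Submodule.span ℂ (Set.range (Binv n hn)) ≤
        Subalgebra.toSubmodule (aeval (R := ℂ) (gens n hn)).range := by
      rw [Submodule.span_le]
      rintro _ ⟨p, rfl⟩
      exact Binv_mem_range n hn p
    exact this hf
  have hs : permAct n (Equiv.swap 1 2) f = f := by
    have : Submodule.span ℂ (Set.range (Binv n hn)) ≤
        LinearMap.eqLocus (permAct n (Equiv.swap 1 2)).toLinearMap LinearMap.id := by
      rw [Submodule.span_le]
      rintro _ ⟨p, rfl⟩
      exact permAct_swap_Binv n hn p
    exact this hf
  exact ⟨(inQ_iff n f).mpr fun t ht => scaleAct_of_mem_range n hn ht hr,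
    permAct_eq_self n (permAct_rotate_of_mem_range n hn hr) hs,
    fun g hg => matAct_of_mem_range n hn hg hr⟩
end

/-- The set `B_inv` is a ℂ-basis of `(Q^{S₃})^{U_n}`. -/
theorem stmt_0 (n : ℕ) (hn : 3 ≤ n) :
    LinearIndependent ℂ (Binv n hn) ∧
      (Submodule.span ℂ (Set.range (Binv n hn)) : Set (P n)) =
        {f : P n | InQ n f ∧ (∀ σ : Equiv.Perm (Fin 3), permAct n σ f = f) ∧ UInv n f} := by
  constructor
  · rw [Binv_eq]
    exact linearIndependent_pow_mul (v := fun q => Binv n hn (0, q)) (toBoundary n)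
      (coords_ne_zero n hn 0 : alpha1 n hn ≠ 0) (toBoundary_gens n hn).1
      (linearIndependent_toBoundary n hn)
  · ext f
    exact ⟨invariant_of_mem_span n hn, fun ⟨hQ, hS, hU⟩ => mem_span_of_invariant n hn hQ hS hU⟩
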